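/- For every real number u, g(u) = u·ψ(u)/(2Ψ(u)) − log Ψ(u) ≥ 0. -/

import Mathlib

open Real

/-- The standard normal probability density function. -/
noncomputable def normalPdf (u : ℝ) : ℝ := (Real.sqrt (2 * Real.pi))⁻¹ * Real.exp (-u ^ 2 / 2)

/-- The standard normal cumulative distribution function. -/
noncomputable def normalCdf (u : ℝ) : ℝ := ∫ t in Set.Iic u, normalPdf t

/-- The per-sample MES acquisition value. -/
noncomputable def mesG (u : ℝ) : ℝ :=
  u * normalPdf u / (2 * normalCdf u) - Real.log (normalCdf u)

lemma normalPdf_eq : normalPdf = ProbabilityTheory.gaussianPDFReal 0 1 := by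
  funext u
  simp [normalPdf, ProbabilityTheory.gaussianPDFReal]

lemma normalPdf_pos (u : ℝ) : 0 < normalPdf u := by
  unfold normalPdf; positivity

lemma normalPdf_integrable : MeasureTheory.Integrable normalPdf := by
  rw [normalPdf_eq]; exact ProbabilityTheory.integrable_gaussianPDFReal 0 1

lemma normalPdf_continuous : Continuous normalPdf := by
  unfold normalPdf; fun_prop

lemma normalCdf_le_one (u : ℝ) : normalCdf u ≤ 1 := by
  have h : ∫ t, normalPdf t = 1 := by
    rw [normalPdf_eq]; exact ProbabilityTheory.integral_gaussianPDFReal_eq_one 0 (by norm_num)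
  rw [← h]
  exact MeasureTheory.setIntegral_le_integral normalPdf_integrable
    (Filter.Eventually.of_forall fun t => (normalPdf_pos t).le)

lemma normalCdf_nonneg (u : ℝ) : 0 ≤ normalCdf u :=
  MeasureTheory.integral_nonneg fun t => (normalPdf_pos t).le

lemma normalCdf_hasDerivAt (u : ℝ) : HasDerivAt normalCdf (normalPdf u) u := by
  have h1 : normalCdf = fun x => normalCdf 0 + ∫ t in (0:ℝ)..x, normalPdf t := by
    funext x
    have := intervalIntegral.integral_Iic_sub_Iic (a := 0) (b := x)
      (normalPdf_integrable.integrableOn) (normalPdf_integrable.integrableOn)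
    rw [← this]; unfold normalCdf; ring
  rw [h1]
  exact (normalPdf_continuous.integral_hasStrictDerivAt 0 u).hasDerivAt.const_add _

lemma normalPdf_hasDerivAt (u : ℝ) : HasDerivAt normalPdf (-u * normalPdf u) u := by
  have h : HasDerivAt (fun x : ℝ => -x ^ 2 / 2) (-u) u := by
    have := ((hasDerivAt_pow 2 u).neg).div_const 2
    exact this.congr_deriv (by norm_num; ring)
  have := (h.exp).const_mul (Real.sqrt (2 * Real.pi))⁻¹
  exact this.congr_deriv (by unfold normalPdf; ring)

lemma normalCdf_strictMono : StrictMono normalCdf := by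
  apply strictMono_of_deriv_pos
  intro x
  rw [(normalCdf_hasDerivAt x).deriv]; exact normalPdf_pos x

lemma normalCdf_pos (u : ℝ) : 0 < normalCdf u :=
  (normalCdf_nonneg (u - 1)).trans_lt (normalCdf_strictMono (by linarith))

lemma mills (u : ℝ) : 0 ≤ (1 + u ^ 2) * normalCdf u + u * normalPdf u := by
  have hd : ∀ x : ℝ, HasDerivAt (fun x => normalCdf x + x * normalPdf x / (1 + x ^ 2))
      (2 * normalPdf x / (1 + x ^ 2) ^ 2) x := by
    intro x
    have hx : (1 + x ^ 2) ≠ 0 := by positivity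
    have := (normalCdf_hasDerivAt x).add ((((hasDerivAt_id x).mul (normalPdf_hasDerivAt x))).div
      ((hasDerivAt_pow 2 x).const_add 1) hx)
    refine this.congr_deriv ?_
    simp
    field_simp
    ring
  have hm : Monotone (fun x => normalCdf x + x * normalPdf x / (1 + x ^ 2)) := by
    apply monotone_of_deriv_nonneg (fun x => (hd x).differentiableAt)
    intro x
    rw [(hd x).deriv]
    have := normalPdf_pos x
    positivity
  have key : 0 ≤ normalCdf u + u * normalPdf u / (1 + u ^ 2) := by
    have ht : Filter.Tendsto (fun v : ℝ => (Real.sqrt (2 * Real.pi))⁻¹ * v⁻¹) Filter.atBot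
        (nhds 0) := by
      simpa using tendsto_inv_atBot_zero.const_mul (Real.sqrt (2 * Real.pi))⁻¹
    refine le_of_tendsto ht ?_
    filter_upwards [Filter.eventually_le_atBot u, Filter.eventually_lt_atBot 0] with v hv hv0
    refine le_trans ?_ (hm hv)
    have h1 := normalCdf_nonneg v
    have h2 : normalPdf v ≤ (Real.sqrt (2 * Real.pi))⁻¹ := by
      unfold normalPdf
      apply mul_le_of_le_one_right (by positivity)
      rw [Real.exp_le_one_iff]; nlinarith [sq_nonneg v]
    have h3 : v⁻¹ ≤ v / (1 + v ^ 2) := by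
      rw [le_div_iff₀ (by positivity)]
      have : v⁻¹ * (1 + v ^ 2) = v⁻¹ + v := by field_simp
      have := inv_lt_zero.2 hv0
      linarith
    have h4 : v⁻¹ < 0 := inv_lt_zero.2 hv0
    have h5 := normalPdf_pos v
    have h6 : v * normalPdf v / (1 + v ^ 2) = normalPdf v * (v / (1 + v ^ 2)) := by ring
    show _ ≤ normalCdf v + v * normalPdf v / (1 + v ^ 2)
    rw [h6]
    nlinarith
  have : (1 + u ^ 2) * normalCdf u + u * normalPdf u
      = (1 + u ^ 2) * (normalCdf u + u * normalPdf u / (1 + u ^ 2)) := by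
    field_simp
  rw [this]; positivity

lemma mesG_antitone : Antitone mesG := by
  have hd : ∀ x : ℝ, HasDerivAt mesG
      (-(normalPdf x / (2 * normalCdf x ^ 2)) *
        ((1 + x ^ 2) * normalCdf x + x * normalPdf x)) x := by
    intro x
    have hx := (normalCdf_pos x).ne'
    have := ((((hasDerivAt_id x).mul (normalPdf_hasDerivAt x))).div
      ((normalCdf_hasDerivAt x).const_mul 2) (by positivity)).sub
      ((normalCdf_hasDerivAt x).log hx)
    refine this.congr_deriv ?_
    simp
    field_simp
    ring
  apply antitone_of_deriv_nonpos (fun x => (hd x).differentiableAt)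
  intro x
  rw [(hd x).deriv]
  have := normalPdf_pos x
  have := mills x
  rw [neg_mul, neg_nonpos]
  positivity

/-- For every real `u`, `g(u) = u·ψ(u)/(2Ψ(u)) − log Ψ(u) ≥ 0`. -/
theorem mesG_nonneg : ∀ u : ℝ, 0 ≤ mesG u := by
  have hp : ∀ u : ℝ, 0 ≤ u → 0 ≤ mesG u := by
    intro u hu
    have h1 := Real.log_nonpos (normalCdf_nonneg u) (normalCdf_le_one u)
    have h2 := normalCdf_pos u
    have h3 := normalPdf_pos u
    have h4 : 0 ≤ u * normalPdf u / (2 * normalCdf u) := by positivity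
    unfold mesG
    linarith
  intro u
  rcases le_total 0 u with h | h
  · exact hp u h
  · exact (hp 0 le_rfl).trans (mesG_antitone h)
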